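/- Let φ be a spherically symmetric wave on D whose horizon limits φ_H and φ_H' exist, and suppose F_p[φ] := ∫_{−∞}^{u₀} |u'|^p·|∂_u φ|(u',v₀) du' + ∫_{v₀}^{∞} |φ_H'(v')| dv' < ∞ for some 0 < p < 1, and that the limit lim_{v→∞} v²·φ_H'(v) exists. Let V : [v₀,∞) → [V₀,M) be defined by V(v) := r(u₀,v), where V₀ := r(u₀,v₀). Then there exists a continuous function Ψ : (−∞,u₀] × [V₀,M] → ℝ such that Ψ(u, V(v)) = ∂_V φ(u,v) := Ω^{−2}(u₀,v)·∂_v φ(u,v) for all (u,v) ∈ (−∞,u₀] × [v₀,∞); that is, the regular outgoing derivative ∂_V φ extends continuously to the Cauchy horizon V = M, so φ extends as a C¹ function beyond the Cauchy horizon. -/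

import Mathlib

open Filter MeasureTheory Set Topology intervalIntegral

noncomputable section

/-- The extremal Reissner--Nordström tortoise function. -/
def rstar (M ρ : ℝ) : ℝ := M ^ 2 / (M - ρ) + 2 * M * Real.log (M - ρ) + ρ

/-- The data of a spherically symmetric wave on the interior region
`D = (-∞, u₀] × [v₀, ∞)` of extremal Reissner--Nordström: the radius function `r`,
the wave `φ` together with its partial derivatives, and the wave equation. -/
structure WaveSetup (M u₀ v₀ : ℝ) where
  hM : 0 < M
  hu₀ : u₀ < 0
  hv₀ : 0 < v₀
  hdom : M + 2 * M * Real.log M < v₀ - u₀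
  /-- the area radius function, defined implicitly by `rstar M (r u v) = v - u` -/
  r : ℝ → ℝ → ℝ
  hr_mem : ∀ u v : ℝ, M + 2 * M * Real.log M < v - u → r u v ∈ Set.Ioo 0 M
  hr_star : ∀ u v : ℝ, M + 2 * M * Real.log M < v - u → rstar M (r u v) = v - u
  /-- the wave -/
  φ : ℝ → ℝ → ℝ
  /-- `∂_u φ` -/
  φu : ℝ → ℝ → ℝ
  /-- `∂_v φ` -/
  φv : ℝ → ℝ → ℝ
  /-- `∂_v ∂_u φ` -/
  φuv : ℝ → ℝ → ℝ
  /-- `∂_v ∂_v φ` -/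
  φvv : ℝ → ℝ → ℝ
  hφu : ∀ u ∈ Set.Iic u₀, ∀ v ∈ Set.Ici v₀,
    HasDerivWithinAt (fun u' => φ u' v) (φu u v) (Set.Iic u₀) u
  hφv : ∀ u ∈ Set.Iic u₀, ∀ v ∈ Set.Ici v₀,
    HasDerivWithinAt (fun v' => φ u v') (φv u v) (Set.Ici v₀) v
  hφuv : ∀ u ∈ Set.Iic u₀, ∀ v ∈ Set.Ici v₀,
    HasDerivWithinAt (fun v' => φu u v') (φuv u v) (Set.Ici v₀) v
  hφvv : ∀ u ∈ Set.Iic u₀, ∀ v ∈ Set.Ici v₀,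
    HasDerivWithinAt (fun v' => φv u v') (φvv u v) (Set.Ici v₀) v
  hφ_cont : ContinuousOn (fun p : ℝ × ℝ => φ p.1 p.2) (Set.Iic u₀ ×ˢ Set.Ici v₀)
  hφu_cont : ContinuousOn (fun p : ℝ × ℝ => φu p.1 p.2) (Set.Iic u₀ ×ˢ Set.Ici v₀)
  hφv_cont : ContinuousOn (fun p : ℝ × ℝ => φv p.1 p.2) (Set.Iic u₀ ×ˢ Set.Ici v₀)
  /-- the wave equation `r ∂_u∂_v φ + (∂_u r) ∂_v φ + (∂_v r) ∂_u φ = 0`,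
  with `∂_u r = -Ω²` and `∂_v r = Ω²`, `Ω² = (1 - M/r)²`. -/
  hwave : ∀ u ∈ Set.Iic u₀, ∀ v ∈ Set.Ici v₀,
    r u v * φuv u v - (1 - M / r u v) ^ 2 * φv u v + (1 - M / r u v) ^ 2 * φu u v = 0

namespace WaveSetup

variable {M u₀ v₀ : ℝ}

/-- The conformal factor `Ω²(u,v) = (1 - M/r(u,v))²`. -/
def Ω2 (W : WaveSetup M u₀ v₀) (u v : ℝ) : ℝ := (1 - M / W.r u v) ^ 2

/-- The regular outgoing derivative `∂_V φ = Ω⁻²(u₀,v) ∂_v φ`. -/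
def dVφ (W : WaveSetup M u₀ v₀) (u v : ℝ) : ℝ := (W.Ω2 u₀ v)⁻¹ * W.φv u v

/-- The regular outgoing derivative of `r φ`:
`∂_V (r φ) = Ω⁻²(u₀,v) (∂_v r · φ + r ∂_v φ)` with `∂_v r = Ω²(u,v)`. -/
def dVrφ (W : WaveSetup M u₀ v₀) (u v : ℝ) : ℝ :=
  (W.Ω2 u₀ v)⁻¹ * (W.Ω2 u v * W.φ u v + W.r u v * W.φv u v)

/-- The second regular outgoing derivative `∂_V² φ = Ω⁻²(u₀,v) ∂_v (∂_V φ)`,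
computed using `∂_v Ω²(u₀,v) = 2 (1 - M/r)(M/r²) Ω²(u₀,v)`. -/
def dV2φ (W : WaveSetup M u₀ v₀) (u v : ℝ) : ℝ :=
  ((W.Ω2 u₀ v)⁻¹) ^ 2 * W.φvv u v
    - 2 * (1 - M / W.r u₀ v) * (M / (W.r u₀ v) ^ 2) * ((W.Ω2 u₀ v)⁻¹) ^ 2 * W.φv u v

/-- `∂_u (r φ) = (∂_u r) φ + r ∂_u φ = -Ω² φ + r ∂_u φ`. -/
def duRφ (W : WaveSetup M u₀ v₀) (u v : ℝ) : ℝ :=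
  -W.Ω2 u v * W.φ u v + W.r u v * W.φu u v

end WaveSetup

/-- A spherically symmetric wave whose horizon limits exist:
`φ_H(v) = lim_{u → -∞} φ(u,v)` and `φ_H'(v) = lim_{u → -∞} ∂_v φ(u,v)` exist
locally uniformly in `v`, with `φ_H` differentiable and `(φ_H)' = φ_H'`. -/
structure WaveSetupH (M u₀ v₀ : ℝ) extends WaveSetup M u₀ v₀ where
  φH : ℝ → ℝ
  φH' : ℝ → ℝ
  hφH_tendsto : TendstoLocallyUniformlyOn (fun u v => φ u v) φH Filter.atBot (Set.Ici v₀)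
  hφH'_tendsto : TendstoLocallyUniformlyOn (fun u v => φv u v) φH' Filter.atBot (Set.Ici v₀)
  hφH_deriv : ∀ v ∈ Set.Ici v₀, HasDerivWithinAt φH (φH' v) (Set.Ici v₀) v

end

lemma hasDerivAt_rstar {M ρ : ℝ} (h : ρ < M) :
    HasDerivAt (rstar M) (ρ ^ 2 / (M - ρ) ^ 2) ρ := by
  have h0 : M - ρ ≠ 0 := (sub_pos.2 h).ne'
  have h1 : HasDerivAt (fun x : ℝ => M - x) (-1) ρ := by
    simpa using (hasDerivAt_id ρ).const_sub M
  have h2 := (((h1.inv h0).const_mul (M ^ 2)).add ((h1.log h0).const_mul (2 * M))).add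
    (hasDerivAt_id ρ)
  refine (h2.congr_deriv ?_).congr_of_eventuallyEq (Eventually.of_forall fun x => ?_)
  · field_simp
    ring
  · simp [rstar, div_eq_mul_inv]

lemma strictMonoOn_rstar {M : ℝ} : StrictMonoOn (rstar M) (Ico 0 M) := by
  refine strictMonoOn_of_deriv_pos (convex_Ico 0 M)
    (fun x hx => (hasDerivAt_rstar hx.2).continuousAt.continuousWithinAt) fun x hx => ?_
  rw [interior_Ico] at hx
  rw [(hasDerivAt_rstar hx.2).deriv]
  exact div_pos (pow_pos hx.1 2) (pow_pos (sub_pos.2 hx.2) 2)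

lemma rstar_zero_lt {M ρ : ℝ} (h : ρ ∈ Ioo 0 M) : M + 2 * M * Real.log M < rstar M ρ := by
  have h0 : 0 < M := h.1.trans h.2
  have := strictMonoOn_rstar ⟨le_rfl, h0⟩ (Ioo_subset_Ico_self h) h.1
  refine lt_of_eq_of_lt ?_ this
  simp [rstar]
  field_simp

lemma tendsto_rstar_atTop {M : ℝ} (hM : 0 < M) : Tendsto (rstar M) (𝓝[<] M) atTop := by
  have h1 : Tendsto (fun ρ : ℝ => M - ρ) (𝓝[<] M) (𝓝[>] 0) := by
    refine tendsto_nhdsWithin_of_tendsto_nhds_of_eventually_within _ ?_ ?_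
    · have : Tendsto (fun ρ : ℝ => M - ρ) (𝓝 M) (𝓝 (M - M)) :=
        tendsto_const_nhds.sub tendsto_id
      rw [sub_self] at this
      exact this.mono_left nhdsWithin_le_nhds
    · filter_upwards [self_mem_nhdsWithin] with ρ hρ
      exact sub_pos.2 (mem_Iio.1 hρ)
  have h2 : Tendsto (fun ρ : ℝ => M ^ 2 + 2 * M * ((M - ρ) * Real.log (M - ρ)) + ρ * (M - ρ))
      (𝓝[<] M) (𝓝 (M ^ 2)) := by
    have hc : Continuous fun ρ : ℝ =>
        M ^ 2 + 2 * M * ((M - ρ) * Real.log (M - ρ)) + ρ * (M - ρ) :=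
      (continuous_const.add (continuous_const.mul
        (Real.continuous_mul_log.comp (continuous_const.sub continuous_id)))).add
        (continuous_id.mul (continuous_const.sub continuous_id))
    have := (hc.tendsto M).mono_left (nhdsWithin_le_nhds (s := Iio M))
    simpa using this
  refine ((h1.inv_tendsto_nhdsGT_zero).atTop_mul_pos (pow_pos hM 2) h2).congr' ?_
  filter_upwards [self_mem_nhdsWithin] with ρ hρ
  have h0 : M - ρ ≠ 0 := (sub_pos.2 hρ).ne'
  simp only [Pi.inv_apply, rstar]
  field_simp

namespace WaveSetup

variable {M u₀ v₀ : ℝ} (W : WaveSetup M u₀ v₀) {u v u' v' : ℝ}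

include W in
lemma dom (hu : u ≤ u₀) (hv : v₀ ≤ v) : M + 2 * M * Real.log M < v - u := by
  linarith [W.hdom]

lemma r_pos (hu : u ≤ u₀) (hv : v₀ ≤ v) : 0 < W.r u v := (W.hr_mem u v (W.dom hu hv)).1

lemma r_lt (hu : u ≤ u₀) (hv : v₀ ≤ v) : W.r u v < M := (W.hr_mem u v (W.dom hu hv)).2

lemma r_eq_of_rstar {ρ : ℝ} (hρ : ρ ∈ Ioo 0 M) (h : rstar M ρ = v - u) : W.r u v = ρ := by
  have hd : M + 2 * M * Real.log M < v - u := h ▸ rstar_zero_lt hρ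
  exact strictMonoOn_rstar.injOn (Ioo_subset_Ico_self (W.hr_mem u v hd))
    (Ioo_subset_Ico_self hρ) ((W.hr_star u v hd).trans h.symm)

lemma r_eq_r_zero (h : M + 2 * M * Real.log M < v - u) : W.r u v = W.r 0 (v - u) := by
  have h' : M + 2 * M * Real.log M < v - u - 0 := by simpa using h
  refine W.r_eq_of_rstar (W.hr_mem 0 _ h') ?_
  rw [W.hr_star 0 _ h', sub_zero]

lemma strictMonoOn_r_zero : StrictMonoOn (W.r 0) (Ioi (M + 2 * M * Real.log M)) := by
  intro x hx y hy hxy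
  have hx' : M + 2 * M * Real.log M < x - 0 := by simpa using hx
  have hy' : M + 2 * M * Real.log M < y - 0 := by simpa using hy
  rw [← strictMonoOn_rstar.lt_iff_lt (Ioo_subset_Ico_self (W.hr_mem 0 x hx'))
    (Ioo_subset_Ico_self (W.hr_mem 0 y hy')), W.hr_star 0 x hx', W.hr_star 0 y hy']
  simpa using hxy

lemma r_le_r (hu : u ≤ u₀) (hv : v₀ ≤ v) (h : v - u ≤ v' - u') : W.r u v ≤ W.r u' v' := by
  have hd := W.dom hu hv
  rw [W.r_eq_r_zero hd, W.r_eq_r_zero (hd.trans_le h)]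
  exact W.strictMonoOn_r_zero.monotoneOn hd (hd.trans_le h) h

lemma continuousAt_r_zero {x : ℝ} (hx : M + 2 * M * Real.log M < x) : ContinuousAt (W.r 0) x := by
  refine W.strictMonoOn_r_zero.continuousAt_of_image_mem_nhds (Ioi_mem_nhds hx) ?_
  have hx' : M + 2 * M * Real.log M < x - 0 := by simpa using hx
  refine mem_of_superset (Ioo_mem_nhds (W.hr_mem 0 x hx').1 (W.hr_mem 0 x hx').2) fun ρ hρ => ?_
  exact ⟨rstar M ρ, rstar_zero_lt hρ, W.r_eq_of_rstar hρ (sub_zero _).symm⟩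

lemma hasDerivAt_r_zero {x : ℝ} (hx : M + 2 * M * Real.log M < x) :
    HasDerivAt (W.r 0) ((1 - M / W.r 0 x) ^ 2) x := by
  have hx' : M + 2 * M * Real.log M < x - 0 := by simpa using hx
  obtain ⟨h0, h1⟩ := W.hr_mem 0 x hx'
  have h2 : M - W.r 0 x ≠ 0 := (sub_pos.2 h1).ne'
  refine (HasDerivAt.of_local_left_inverse (W.continuousAt_r_zero hx) (hasDerivAt_rstar h1)
    (by positivity) ?_).congr_deriv ?_
  · filter_upwards [Ioi_mem_nhds hx] with y hy
    have hy' : M + 2 * M * Real.log M < y - 0 := by simpa using hy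
    simpa using W.hr_star 0 y hy'
  · field_simp
    ring

lemma hasDerivAt_r_right (hu : u ≤ u₀) (hv : v₀ ≤ v) :
    HasDerivAt (fun s => W.r u s) (W.Ω2 u v) v := by
  have hd := W.dom hu hv
  have h1 : HasDerivAt (fun s => W.r 0 (s - u)) ((1 - M / W.r 0 (v - u)) ^ 2 * 1) v :=
    (W.hasDerivAt_r_zero hd).comp v ((hasDerivAt_id v).sub_const u)
  rw [mul_one, ← W.r_eq_r_zero hd] at h1
  refine h1.congr_of_eventuallyEq ?_
  filter_upwards [Ioi_mem_nhds (show M + 2 * M * Real.log M + u < v by linarith)] with s hs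
  exact W.r_eq_r_zero (by linarith [mem_Ioi.1 hs])

lemma hasDerivAt_r_left (hu : u ≤ u₀) (hv : v₀ ≤ v) :
    HasDerivAt (fun s => W.r s v) (-W.Ω2 u v) u := by
  have hd := W.dom hu hv
  have h1 : HasDerivAt (fun s => W.r 0 (v - s)) ((1 - M / W.r 0 (v - u)) ^ 2 * (-1)) u :=
    (W.hasDerivAt_r_zero hd).comp u ((hasDerivAt_id u).const_sub v)
  rw [mul_neg_one, ← W.r_eq_r_zero hd] at h1
  refine h1.congr_of_eventuallyEq ?_
  filter_upwards [Iio_mem_nhds (show u < v - (M + 2 * M * Real.log M) by linarith)] with s hs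
  exact W.r_eq_r_zero (by linarith [mem_Iio.1 hs])

lemma continuousOn_r :
    ContinuousOn (fun x : ℝ × ℝ => W.r x.1 x.2) (Iic u₀ ×ˢ Ici v₀) := by
  have h : ContinuousOn (fun x : ℝ × ℝ => W.r 0 (x.2 - x.1)) (Iic u₀ ×ˢ Ici v₀) := by
    intro x hx
    exact ((W.continuousAt_r_zero (W.dom hx.1 hx.2)).comp
      (f := fun x : ℝ × ℝ => x.2 - x.1) (by fun_prop)).continuousWithinAt
  exact h.congr fun x hx => W.r_eq_r_zero (W.dom hx.1 hx.2)

lemma continuousOn_Ω2 :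
    ContinuousOn (fun x : ℝ × ℝ => W.Ω2 x.1 x.2) (Iic u₀ ×ˢ Ici v₀) :=
  (continuousOn_const.sub (continuousOn_const.div W.continuousOn_r
    fun _ hx => (W.r_pos hx.1 hx.2).ne')).pow 2

lemma Ω2_pos (hu : u ≤ u₀) (hv : v₀ ≤ v) : 0 < W.Ω2 u v := by
  have h : 1 < M / W.r u v := (one_lt_div (W.r_pos hu hv)).2 (W.r_lt hu hv)
  exact sq_pos_iff.2 (sub_ne_zero.2 h.ne)

lemma Ω2_le_Ω2 (hu : u ≤ u₀) (hv : v₀ ≤ v) : W.Ω2 u v ≤ W.Ω2 u₀ v := by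
  have h0 := W.r_pos le_rfl hv
  have h1 : W.r u₀ v ≤ W.r u v := W.r_le_r le_rfl hv (by linarith)
  have h2 : 1 ≤ M / W.r u v := (one_le_div (W.r_pos hu hv)).2 (W.r_lt hu hv).le
  have h3 : M / W.r u v ≤ M / W.r u₀ v := div_le_div_of_nonneg_left W.hM.le h0 h1
  unfold Ω2
  nlinarith

lemma r_ge (hu : u ≤ u₀) (hv : v₀ ≤ v) : W.r u₀ v₀ ≤ W.r u v :=
  W.r_le_r le_rfl le_rfl (by linarith)

lemma sub_r_mul (hu : u ≤ u₀) (hv : v₀ ≤ v) :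
    (M - W.r u v) * (v - u) = M ^ 2 + 2 * M * ((M - W.r u v) * Real.log (M - W.r u v))
      + W.r u v * (M - W.r u v) := by
  have h : M - W.r u v ≠ 0 := (sub_pos.2 (W.r_lt hu hv)).ne'
  rw [← W.hr_star u v (W.dom hu hv), rstar]
  field_simp

lemma exists_sub_r_mul_le : ∃ C, 0 < C ∧ ∀ u ≤ u₀, ∀ v, v₀ ≤ v → (M - W.r u v) * (v - u) ≤ C := by
  have hM := W.hM
  refine ⟨M ^ 2 + 2 * M * (M * |Real.log M|) + M * M, by positivity, fun u hu v hv => ?_⟩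
  have h0 := W.r_pos hu hv
  have h1 := W.r_lt hu hv
  have h2 : Real.log (M - W.r u v) ≤ |Real.log M| :=
    (Real.log_le_log (by linarith) (by linarith)).trans (le_abs_self _)
  have h3 : (M - W.r u v) * Real.log (M - W.r u v) ≤ M * |Real.log M| :=
    (mul_le_mul_of_nonneg_left h2 (by linarith)).trans
      (mul_le_mul_of_nonneg_right (by linarith) (abs_nonneg _))
  rw [W.sub_r_mul hu hv]
  gcongr
  linarith

lemma exists_Ω2_le : ∃ c, 0 < c ∧ ∀ u ≤ u₀, ∀ v, v₀ ≤ v → W.Ω2 u v * (v - u) ^ 2 ≤ c := by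
  obtain ⟨C, hC, h⟩ := W.exists_sub_r_mul_le
  have hr := W.r_pos le_rfl le_rfl
  refine ⟨(C / W.r u₀ v₀) ^ 2, by positivity, fun u hu v hv => ?_⟩
  have h0 := W.r_pos hu hv
  have h1 := W.r_lt hu hv
  have h2 : 0 ≤ (M - W.r u v) * (v - u) :=
    mul_nonneg (by linarith) (by linarith [W.hu₀, W.hv₀])
  have h3 : W.Ω2 u v * (v - u) ^ 2 = ((M - W.r u v) * (v - u) / W.r u v) ^ 2 := by
    unfold Ω2
    field_simp
    ring
  rw [h3]
  have := W.r_ge hu hv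
  gcongr
  exact h u hu v hv

section Limits

variable {ι : Type*} {l : Filter ι} {a b : ι → ℝ}

lemma tendsto_r (ha : ∀ᶠ i in l, a i ≤ u₀) (hb : ∀ᶠ i in l, v₀ ≤ b i)
    (h : Tendsto (fun i => b i - a i) l atTop) : Tendsto (fun i => W.r (a i) (b i)) l (𝓝 M) := by
  obtain ⟨C, -, hC⟩ := W.exists_sub_r_mul_le
  have h1 : Tendsto (fun i => M - C * (b i - a i)⁻¹) l (𝓝 M) := by
    simpa using (h.inv_tendsto_atTop.const_mul C).const_sub M
  refine tendsto_of_tendsto_of_tendsto_of_le_of_le' h1 tendsto_const_nhds ?_ ?_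
  · filter_upwards [ha, hb, h.eventually_gt_atTop 0] with i hi hi' hi''
    have := (le_div_iff₀ hi'').2 (hC _ hi _ hi')
    rw [div_eq_mul_inv] at this
    linarith
  · filter_upwards [ha, hb] with i hi hi'
    exact (W.r_lt hi hi').le

lemma tendsto_Ω2_mul_sq (ha : ∀ᶠ i in l, a i ≤ u₀) (hb : ∀ᶠ i in l, v₀ ≤ b i)
    (h : Tendsto (fun i => b i - a i) l atTop) :
    Tendsto (fun i => W.Ω2 (a i) (b i) * (b i - a i) ^ 2) l (𝓝 (M ^ 2)) := by
  have hM := W.hM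
  have hc : ContinuousAt (fun ρ : ℝ =>
      ((M ^ 2 + 2 * M * ((M - ρ) * Real.log (M - ρ)) + ρ * (M - ρ)) / ρ) ^ 2) M := by
    refine ContinuousAt.pow (ContinuousAt.div ?_ continuousAt_id hM.ne') 2
    exact ((continuous_const.add (continuous_const.mul
      (Real.continuous_mul_log.comp (continuous_const.sub continuous_id)))).add
      (continuous_id.mul (continuous_const.sub continuous_id))).continuousAt
  have h1 := hc.tendsto.comp (W.tendsto_r ha hb h)
  have h2 : ((M ^ 2 + 2 * M * ((M - M) * Real.log (M - M)) + M * (M - M)) / M) ^ 2 = M ^ 2 := by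
    simp
    field_simp
  rw [h2] at h1
  refine h1.congr' ?_
  filter_upwards [ha, hb] with i hi hi'
  have h0 := W.r_pos hi hi'
  simp only [Function.comp]
  rw [← W.sub_r_mul hi hi', Ω2]
  field_simp
  ring

end Limits

end WaveSetup

lemma continuousOn_left_of_prod {f : ℝ → ℝ → ℝ} {s t : Set ℝ} {y : ℝ}
    (hf : ContinuousOn (fun x : ℝ × ℝ => f x.1 x.2) (s ×ˢ t)) (hy : y ∈ t) :
    ContinuousOn (fun x => f x y) s :=
  hf.comp (f := fun x => (x, y)) (by fun_prop) fun _ hx => ⟨hx, hy⟩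

lemma continuousOn_right_of_prod {f : ℝ → ℝ → ℝ} {s t : Set ℝ} {x : ℝ}
    (hf : ContinuousOn (fun x : ℝ × ℝ => f x.1 x.2) (s ×ˢ t)) (hx : x ∈ s) :
    ContinuousOn (fun y => f x y) t :=
  hf.comp (f := fun y => (x, y)) (by fun_prop) fun _ hy => ⟨hx, hy⟩

/-- Symmetry of mixed partial derivatives in integrated form, on a quadrant. -/
lemma sub_eq_integral_mixed_deriv {f fu fv k : ℝ → ℝ → ℝ} {u₀ v₀ a b v : ℝ}
    (hfu : ∀ u ∈ Iic u₀, ∀ v ∈ Ici v₀,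
      HasDerivWithinAt (fun x => f x v) (fu u v) (Iic u₀) u)
    (hfv : ∀ u ∈ Iic u₀, ∀ v ∈ Ici v₀,
      HasDerivWithinAt (fun y => f u y) (fv u v) (Ici v₀) v)
    (hk : ∀ u ∈ Iic u₀, ∀ v ∈ Ici v₀,
      HasDerivWithinAt (fun y => fu u y) (k u v) (Ici v₀) v)
    (hfu_cont : ContinuousOn (fun x : ℝ × ℝ => fu x.1 x.2) (Iic u₀ ×ˢ Ici v₀))
    (hk_cont : ContinuousOn (fun x : ℝ × ℝ => k x.1 x.2) (Iic u₀ ×ˢ Ici v₀))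
    (hab : a ≤ b) (hb : b ≤ u₀) (hv : v₀ < v) :
    fv b v - fv a v = ∫ u in a..b, k u v := by
  have hsub : Icc a b ⊆ Iic u₀ := fun x hx => hx.2.trans hb
  have huIoc : uIoc a b = Ioc a b := uIoc_of_le hab
  have hint : ∀ {g : ℝ → ℝ → ℝ} {y : ℝ},
      ContinuousOn (fun x : ℝ × ℝ => g x.1 x.2) (Iic u₀ ×ˢ Ici v₀) → y ∈ Ici v₀ →
      IntervalIntegrable (fun x => g x y) volume a b := fun hg hy =>
    ((continuousOn_left_of_prod hg hy).mono
      (by rw [uIcc_of_le hab]; exact hsub)).intervalIntegrable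
  obtain ⟨C, hC⟩ := (isCompact_Icc.prod isCompact_Icc).exists_bound_of_continuousOn
    (hk_cont.mono (prod_mono hsub (Icc_subset_Ici_self : Icc v₀ (v + 1) ⊆ Ici v₀)))
  have hG := (intervalIntegral.hasDerivAt_integral_of_dominated_loc_of_deriv_le
    (μ := volume) (a := a) (b := b) (bound := fun _ => C) (F := fun y x => fu x y)
    (F' := fun y x => k x y) (Ioo_mem_nhds hv (lt_add_one v))
    (by
      filter_upwards [Ioi_mem_nhds hv] with y hy
      rw [huIoc]
      exact (hint hfu_cont (mem_Ici.2 (le_of_lt hy))).1.aestronglyMeasurable)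
    (hint hfu_cont (mem_Ici.2 hv.le))
    (by rw [huIoc]; exact (hint hk_cont (mem_Ici.2 hv.le)).1.aestronglyMeasurable)
    (Eventually.of_forall fun x hx y hy => by
      rw [huIoc] at hx
      exact hC (x, y) ⟨Ioc_subset_Icc_self hx, Ioo_subset_Icc_self hy⟩)
    intervalIntegrable_const
    (Eventually.of_forall fun x hx y hy => by
      rw [huIoc] at hx
      exact (hk x (hx.2.trans hb) y (mem_Ici.2 hy.1.le)).hasDerivAt (Ici_mem_nhds hy.1))).2
  have hd := ((hfv b hb v hv.le).hasDerivAt (Ici_mem_nhds hv)).sub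
    ((hfv a (hab.trans hb) v hv.le).hasDerivAt (Ici_mem_nhds hv))
  refine hd.unique (hG.congr_of_eventuallyEq ?_)
  filter_upwards [Ioi_mem_nhds hv] with y hy
  have hy' : y ∈ Ici v₀ := mem_Ici.2 (le_of_lt hy)
  refine (intervalIntegral.integral_eq_sub_of_hasDerivAt_of_le hab
    (fun x hx => ((hfu x (hsub hx) y hy').continuousWithinAt).mono hsub) (fun x hx => ?_)
    (hint hfu_cont hy')).symm
  exact (hfu x (hx.2.le.trans hb) y hy').hasDerivAt (Iic_mem_nhds (hx.2.trans_le hb))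

lemma integrableOn_inv_sq {s : Set ℝ} {a : ℝ} (hs : MeasurableSet s) (ha : 0 < a)
    (h : ∀ x ∈ s, a ≤ |x|) : IntegrableOn (fun x : ℝ => (x ^ 2)⁻¹) s := by
  refine Integrable.mono' ((integrable_inv_one_add_sq.const_mul (1 + (a ^ 2)⁻¹)).integrableOn)
    (by fun_prop) ((ae_restrict_iff' hs).2 (Eventually.of_forall fun x hx => ?_))
  have h1 : a ^ 2 ≤ x ^ 2 := by
    rw [← sq_abs x]
    exact pow_le_pow_left₀ ha.le (h x hx) 2
  have h2 : 0 < a ^ 2 := by positivity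
  have h3 : 0 < x ^ 2 := h2.trans_le h1
  have h4 : (x ^ 2)⁻¹ ≤ (a ^ 2)⁻¹ := inv_anti₀ h2 h1
  rw [Real.norm_of_nonneg (by positivity), ← div_eq_mul_inv, le_div_iff₀ (by positivity)]
  have : (x ^ 2)⁻¹ * (1 + x ^ 2) = 1 + (x ^ 2)⁻¹ := by
    rw [mul_add, mul_one, inv_mul_cancel₀ h3.ne', add_comm]
  linarith

namespace WaveSetup

variable {M u₀ v₀ : ℝ} (W : WaveSetup M u₀ v₀) {u v u' v' : ℝ}

lemma φuv_eq (hu : u ≤ u₀) (hv : v₀ ≤ v) :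
    W.φuv u v = W.Ω2 u v / W.r u v * (W.φv u v - W.φu u v) := by
  have h := W.hwave u hu v hv
  have h0 := W.r_pos hu hv
  unfold Ω2
  field_simp at h ⊢
  linarith

lemma continuousOn_φuv :
    ContinuousOn (fun x : ℝ × ℝ => W.φuv x.1 x.2) (Iic u₀ ×ˢ Ici v₀) :=
  ((W.continuousOn_Ω2.div W.continuousOn_r fun _ hx => (W.r_pos hx.1 hx.2).ne').mul
    (W.hφv_cont.sub W.hφu_cont)).congr fun _ hx => W.φuv_eq hx.1 hx.2

lemma continuousOn_Ω2_mul_φu :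
    ContinuousOn (fun x : ℝ × ℝ => W.Ω2 x.1 x.2 * W.φu x.1 x.2) (Iic u₀ ×ˢ Ici v₀) :=
  W.continuousOn_Ω2.mul W.hφu_cont

lemma continuousOn_Ω2_mul_φv :
    ContinuousOn (fun x : ℝ × ℝ => W.Ω2 x.1 x.2 * W.φv x.1 x.2) (Iic u₀ ×ˢ Ici v₀) :=
  W.continuousOn_Ω2.mul W.hφv_cont

lemma r_mul_φu_eq (hu : u ≤ u₀) (hv : v₀ ≤ v) :
    W.r u v * W.φu u v = W.r u v₀ * W.φu u v₀ + ∫ s in v₀..v, W.Ω2 u s * W.φv u s := by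
  rw [intervalIntegral.integral_eq_sub_of_hasDeriv_right_of_le
    (f := fun s => W.r u s * W.φu u s) hv]
  · ring
  · exact (continuousOn_right_of_prod (f := fun u v => W.r u v * W.φu u v)
      (W.continuousOn_r.mul W.hφu_cont) (mem_Iic.2 hu)).mono Icc_subset_Ici_self
  · intro s hs
    have h := ((W.hasDerivAt_r_right hu hs.1.le).mul
      ((W.hφuv u hu s hs.1.le).hasDerivAt (Ici_mem_nhds hs.1))).hasDerivWithinAt (s := Ioi s)
    refine h.congr_deriv ?_
    have := W.r_pos hu hs.1.le
    rw [W.φuv_eq hu hs.1.le]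
    field_simp
    ring
  · refine ContinuousOn.intervalIntegrable ?_
    rw [uIcc_of_le hv]
    exact (continuousOn_right_of_prod (f := fun u v => W.Ω2 u v * W.φv u v)
      W.continuousOn_Ω2_mul_φv (mem_Iic.2 hu)).mono
      Icc_subset_Ici_self

lemma φv_sub_eq (h : u' ≤ u) (hu : u ≤ u₀) (hv : v₀ < v) :
    W.φv u v - W.φv u' v = ∫ s in u'..u, W.φuv s v :=
  sub_eq_integral_mixed_deriv W.hφu W.hφv W.hφuv W.hφu_cont W.continuousOn_φuv h hu hv

lemma hasDerivAt_φv_left (hu : u < u₀) (hv : v₀ < v) :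
    HasDerivAt (fun s => W.φv s v) (W.φuv u v) u := by
  have hc := continuousOn_left_of_prod W.continuousOn_φuv (mem_Ici.2 hv.le)
  have hsub : uIcc (u - 1) u ⊆ Iic u₀ := by
    rw [uIcc_of_le (by linarith)]
    exact fun x hx => hx.2.trans hu.le
  have h := (intervalIntegral.integral_hasDerivAt_right (a := u - 1) (b := u)
    (hc.mono hsub).intervalIntegrable
    ((hc.mono Iio_subset_Iic_self).stronglyMeasurableAtFilter isOpen_Iio u hu)
    (hc.continuousAt (Iic_mem_nhds hu))).const_add (W.φv (u - 1) v)
  refine h.congr_of_eventuallyEq ?_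
  filter_upwards [Ioo_mem_nhds (sub_one_lt u) hu] with s hs
  rw [← W.φv_sub_eq hs.1.le hs.2.le hv]
  ring

lemma r_mul_φv_eq (h : u' ≤ u) (hu : u ≤ u₀) (hv : v₀ < v) :
    W.r u v * W.φv u v = W.r u' v * W.φv u' v - ∫ s in u'..u, W.Ω2 s v * W.φu s v := by
  have hsub : Icc u' u ⊆ Iic u₀ := fun x hx => hx.2.trans hu
  rw [sub_eq_add_neg, ← intervalIntegral.integral_neg,
    intervalIntegral.integral_eq_sub_of_hasDerivAt_of_le
    (f := fun s => W.r s v * W.φv s v) h]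
  · ring
  · exact (continuousOn_left_of_prod (f := fun u v => W.r u v * W.φv u v)
      (W.continuousOn_r.mul W.hφv_cont) (mem_Ici.2 hv.le)).mono hsub
  · intro s hs
    have hs' : s < u₀ := hs.2.trans_le hu
    refine ((W.hasDerivAt_r_left hs'.le hv.le).mul (W.hasDerivAt_φv_left hs' hv)).congr_deriv ?_
    have := W.r_pos hs'.le hv.le
    rw [W.φuv_eq hs'.le hv.le]
    field_simp
    ring
  · refine ContinuousOn.intervalIntegrable ?_
    rw [uIcc_of_le h]
    exact ((continuousOn_left_of_prod (f := fun u v => W.Ω2 u v * W.φu u v)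
      W.continuousOn_Ω2_mul_φu (mem_Ici.2 hv.le)).mono hsub).neg

end WaveSetup

namespace WaveSetup

variable {M u₀ v₀ : ℝ} (W : WaveSetup M u₀ v₀) {u v c A : ℝ}

lemma Ω2_le_inv_sq_left (hc : ∀ u ≤ u₀, ∀ v, v₀ ≤ v → W.Ω2 u v * (v - u) ^ 2 ≤ c)
    (hu : u ≤ u₀) (hv : v₀ ≤ v) : W.Ω2 u v ≤ c * (u ^ 2)⁻¹ := by
  have h1 : u < 0 := hu.trans_lt W.hu₀
  have h2 : 0 < v := W.hv₀.trans_le hv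
  have h3 : u ^ 2 ≤ (v - u) ^ 2 := by nlinarith
  rw [← div_eq_mul_inv, le_div_iff₀ (sq_pos_iff.2 h1.ne)]
  exact (mul_le_mul_of_nonneg_left h3 (W.Ω2_pos hu hv).le).trans (hc u hu v hv)

lemma Ω2_le_inv_sq_right (hc : ∀ u ≤ u₀, ∀ v, v₀ ≤ v → W.Ω2 u v * (v - u) ^ 2 ≤ c)
    (hu : u ≤ u₀) (hv : v₀ ≤ v) : W.Ω2 u v ≤ c * (v ^ 2)⁻¹ := by
  have h1 : u < 0 := hu.trans_lt W.hu₀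
  have h2 : 0 < v := W.hv₀.trans_le hv
  have h3 : v ^ 2 ≤ (v - u) ^ 2 := by nlinarith
  rw [← div_eq_mul_inv, le_div_iff₀ (by positivity)]
  exact (mul_le_mul_of_nonneg_left h3 (W.Ω2_pos hu hv).le).trans (hc u hu v hv)

lemma abs_le_of_abs_r_mul_le {x : ℝ} (hu : u ≤ u₀) (hv : v₀ ≤ v) (h : |W.r u v * x| ≤ A) :
    |x| ≤ A / W.r u₀ v₀ := by
  have h0 := W.r_pos le_rfl le_rfl
  rw [le_div_iff₀ h0]
  rw [abs_mul, abs_of_pos (W.r_pos hu hv)] at h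
  have := mul_le_mul_of_nonneg_right (W.r_ge hu hv) (abs_nonneg x)
  linarith

/-- Inverse-square decay of `r ∂_v φ` along an outgoing ray controls `∂_u φ` on it. -/
lemma abs_φu_le (hc0 : 0 ≤ c) (hc : ∀ u ≤ u₀, ∀ v, v₀ ≤ v → W.Ω2 u v * (v - u) ^ 2 ≤ c)
    (hu : u ≤ u₀) (hv : v₀ < v) (hA : ∀ s ∈ Ioc v₀ v, |W.r u s * W.φv u s| * s ^ 2 ≤ A) :
    |W.φu u v| ≤ (M * |W.φu u v₀| + c * A / (W.r u₀ v₀ * v₀) * (u ^ 2)⁻¹) / W.r u₀ v₀ := by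
  have hv0 := W.hv₀
  have hr0 := W.r_pos le_rfl le_rfl
  have hA0 : 0 ≤ A := (by positivity : (0 : ℝ) ≤ _).trans (hA v ⟨hv, le_rfl⟩)
  have hderiv : ∀ s ∈ uIcc v₀ v, HasDerivAt (fun s : ℝ => -s⁻¹) ((s ^ 2)⁻¹) s := by
    intro s hs
    rw [uIcc_of_le hv.le] at hs
    have := (hasDerivAt_inv (hv0.trans_le hs.1).ne').neg
    rwa [neg_neg] at this
  have hint : IntervalIntegrable (fun s : ℝ => (s ^ 2)⁻¹) volume v₀ v := by
    refine ContinuousOn.intervalIntegrable ?_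
    rw [uIcc_of_le hv.le]
    exact ContinuousOn.inv₀ (by fun_prop) fun s hs => (pow_pos (hv0.trans_le hs.1) 2).ne'
  have hI : |∫ s in v₀..v, W.Ω2 u s * W.φv u s|
      ≤ ∫ s in v₀..v, c * (u ^ 2)⁻¹ * (A / W.r u₀ v₀) * (s ^ 2)⁻¹ := by
    rw [← Real.norm_eq_abs]
    refine intervalIntegral.norm_integral_le_of_norm_le hv.le
      (Eventually.of_forall fun s hs => ?_) (hint.const_mul _)
    have hs0 : 0 < s := hv0.trans hs.1
    have h1 : |W.r u s * W.φv u s| ≤ A * (s ^ 2)⁻¹ := by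
      rw [← div_eq_mul_inv, le_div_iff₀ (by positivity)]
      exact hA s hs
    have h2 := W.abs_le_of_abs_r_mul_le hu hs.1.le h1
    rw [Real.norm_eq_abs, abs_mul, abs_of_pos (W.Ω2_pos hu hs.1.le)]
    calc W.Ω2 u s * |W.φv u s| ≤ c * (u ^ 2)⁻¹ * (A * (s ^ 2)⁻¹ / W.r u₀ v₀) := by
          gcongr
          exact W.Ω2_le_inv_sq_left hc hu hs.1.le
      _ = _ := by ring
  rw [intervalIntegral.integral_const_mul,
    intervalIntegral.integral_eq_sub_of_hasDerivAt hderiv hint] at hI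
  have hv1 : -v⁻¹ - -v₀⁻¹ ≤ v₀⁻¹ := by
    have : 0 < v⁻¹ := inv_pos.2 (hv0.trans hv)
    linarith
  have hI2 := hI.trans (mul_le_mul_of_nonneg_left hv1 (by positivity))
  refine W.abs_le_of_abs_r_mul_le hu hv.le ?_
  rw [W.r_mul_φu_eq hu hv.le]
  refine (abs_add_le _ _).trans (add_le_add ?_ (hI2.trans_eq ?_))
  · rw [abs_mul, abs_of_pos (W.r_pos hu le_rfl)]
    exact mul_le_mul_of_nonneg_right (W.r_lt hu le_rfl).le (abs_nonneg _)
  · field_simp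

lemma integrableOn_φu_of_weighted {p : ℝ} (hp : 0 < p)
    (h : IntegrableOn (fun u => |u| ^ p * |W.φu u v₀|) (Iic u₀)) :
    IntegrableOn (fun u => W.φu u v₀) (Iic u₀) := by
  have hu0 : 0 < |u₀| := abs_pos.2 W.hu₀.ne
  refine Integrable.mono' (h.const_mul (|u₀| ^ p)⁻¹)
    ((continuousOn_left_of_prod W.hφu_cont self_mem_Ici).aestronglyMeasurable measurableSet_Iic)
    ((ae_restrict_iff' measurableSet_Iic).2 (Eventually.of_forall fun u hu => ?_))
  have h1 : |u₀| ^ p ≤ |u| ^ p := by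
    refine Real.rpow_le_rpow hu0.le ?_ hp.le
    rw [abs_of_neg W.hu₀, abs_of_neg (lt_of_le_of_lt hu W.hu₀)]
    exact neg_le_neg hu
  have h2 : 0 < |u₀| ^ p := Real.rpow_pos_of_pos hu0 p
  rw [Real.norm_eq_abs, ← mul_assoc, ← div_eq_inv_mul]
  exact le_mul_of_one_le_left (abs_nonneg _) ((one_le_div h2).2 h1)

end WaveSetup

namespace WaveSetupH

variable {M u₀ v₀ : ℝ} (W : WaveSetupH M u₀ v₀) {u v c A K S : ℝ}

lemma continuousOn_φH' : ContinuousOn W.φH' (Ici v₀) :=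
  W.hφH'_tendsto.continuousOn ((eventually_le_atBot u₀).mono fun _ hu =>
    continuousOn_right_of_prod W.hφv_cont (mem_Iic.2 hu)).frequently

lemma exists_abs_φv_le (b : ℝ) : ∃ B, ∀ u ≤ u₀, ∀ v ∈ Icc v₀ b, |W.φv u v| ≤ B := by
  have h := (tendstoLocallyUniformlyOn_iff_tendstoUniformlyOn_of_compact isCompact_Icc).1
    (W.hφH'_tendsto.mono (Icc_subset_Ici_self : Icc v₀ b ⊆ _))
  obtain ⟨a, ha⟩ := eventually_atBot.1 (Metric.tendstoUniformlyOn_iff.1 h 1 one_pos)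
  obtain ⟨B₁, hB₁⟩ := (isCompact_Icc (a := v₀) (b := b)).exists_bound_of_continuousOn
    (W.continuousOn_φH'.mono (Icc_subset_Ici_self : Icc v₀ b ⊆ _))
  obtain ⟨B₂, hB₂⟩ := (isCompact_Icc.prod isCompact_Icc).exists_bound_of_continuousOn
    (W.hφv_cont.mono (prod_mono (Icc_subset_Iic_self : Icc a u₀ ⊆ _)
      (Icc_subset_Ici_self : Icc v₀ b ⊆ _)))
  refine ⟨max (B₁ + 1) B₂, fun u hu v hv => ?_⟩
  rcases le_total u a with hua | hua
  · refine le_max_of_le_left ?_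
    have h1 := ha u hua v hv
    have h2 := hB₁ v hv
    rw [dist_comm, Real.dist_eq] at h1
    rw [Real.norm_eq_abs] at h2
    have := abs_add_le (W.φv u v - W.φH' v) (W.φH' v)
    rw [sub_add_cancel] at this
    linarith
  · exact le_max_of_le_right (hB₂ (u, v) ⟨⟨hua, hu⟩, hv⟩)

lemma exists_abs_φH'_mul_sq_le {L : ℝ} (h : Tendsto (fun v => v ^ 2 * W.φH' v) atTop (𝓝 L)) :
    ∃ C, 0 ≤ C ∧ ∀ v, v₀ ≤ v → |W.φH' v| * v ^ 2 ≤ C := by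
  obtain ⟨b, hb⟩ := eventually_atTop.1 (h.abs.eventually_le_const (lt_add_one |L|))
  obtain ⟨B, hB⟩ := isCompact_Icc.exists_bound_of_continuousOn
    (((continuous_pow 2).continuousOn.mul W.continuousOn_φH').mono
      (Icc_subset_Ici_self : Icc v₀ b ⊆ _))
  refine ⟨max (|L| + 1) B, le_max_of_le_left (by positivity), fun v hv => ?_⟩
  have h1 : |W.φH' v| * v ^ 2 = |v ^ 2 * W.φH' v| := by
    rw [abs_mul, abs_of_nonneg (sq_nonneg v), mul_comm]
  rw [h1]
  rcases le_total v b with hvb | hvb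
  · exact le_max_of_le_right (hB v ⟨hv, hvb⟩)
  · exact le_max_of_le_left (hb v hvb)

lemma tendsto_r_mul_φv (hv : v₀ ≤ v) :
    Tendsto (fun s => W.r s v * W.φv s v) atBot (𝓝 (M * W.φH' v)) :=
  (W.tendsto_r (eventually_le_atBot u₀) (Eventually.of_forall fun _ => hv)
    (tendsto_atTop_add_const_left _ v tendsto_neg_atBot_atTop)).mul
    (W.hφH'_tendsto.tendsto_at hv)

/-- The improvement step of the Grönwall-type estimate for `v² r ∂_v φ`, with the weight
`exp (-λ / u)`. -/
lemma decay_step {C l b : ℝ} (hc0 : 0 < c)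
    (hc : ∀ u ≤ u₀, ∀ v, v₀ ≤ v → W.Ω2 u v * (v - u) ^ 2 ≤ c)
    (hC : ∀ v, v₀ ≤ v → |W.φH' v| * v ^ 2 ≤ C)
    (hq : IntegrableOn (fun u => W.φu u v₀) (Iic u₀))
    (hl : l = 2 * c ^ 2 / (W.r u₀ v₀ ^ 2 * v₀))
    (hK : K = M * C + c * M / W.r u₀ v₀ * ∫ s in Iic u₀, |W.φu s v₀|)
    (hS0 : 0 ≤ S)
    (hS : ∀ u ≤ u₀, ∀ v ∈ Ioc v₀ b,
      |W.r u v * W.φv u v| * v ^ 2 ≤ S * Real.exp (-(l * u⁻¹)))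
    (hu : u ≤ u₀) (hv : v ∈ Ioc v₀ b) :
    |W.r u v * W.φv u v| * v ^ 2 ≤ (K + S / 2) * Real.exp (-(l * u⁻¹)) := by
  have hM := W.hM
  have hv0 := W.hv₀
  have hr0 := W.r_pos le_rfl le_rfl
  have hl0 : 0 < l := by rw [hl]; positivity
  have hvpos : 0 < v := hv0.trans hv.1
  have hE1 : 1 ≤ Real.exp (-(l * u⁻¹)) := by
    have : u⁻¹ < 0 := inv_lt_zero.2 (hu.trans_lt W.hu₀)
    exact Real.one_le_exp (by nlinarith)
  have hQ0 : 0 ≤ ∫ s in Iic u₀, |W.φu s v₀| := integral_nonneg fun _ => abs_nonneg _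
  have hderiv : ∀ s ≤ u₀, HasDerivAt (fun s : ℝ => Real.exp (-(l * s⁻¹)) / l)
      (Real.exp (-(l * s⁻¹)) * (s ^ 2)⁻¹) s := by
    intro s hs
    have h := (((hasDerivAt_inv (hs.trans_lt W.hu₀).ne).const_mul l).neg.exp).div_const l
    refine h.congr_deriv ?_
    simp only [Pi.neg_apply]
    field_simp
  have hbound : ∀ a ≤ u, |W.r u v * W.φv u v| * v ^ 2 ≤ |W.r a v * W.φv a v| * v ^ 2 +
      (c * M / W.r u₀ v₀ * (∫ s in Iic u₀, |W.φu s v₀|)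
        + S / 2 * Real.exp (-(l * u⁻¹))) := by
    intro a ha
    have hsub : uIcc a u ⊆ Iic u₀ := by
      rw [uIcc_of_le ha]
      exact fun x hx => hx.2.trans hu
    have hi1 : IntervalIntegrable (fun s => |W.φu s v₀|) volume a u :=
      ((continuousOn_left_of_prod W.hφu_cont self_mem_Ici).abs.mono hsub).intervalIntegrable
    have hi2 : IntervalIntegrable (fun s => Real.exp (-(l * s⁻¹)) * (s ^ 2)⁻¹) volume a u := by
      refine ContinuousOn.intervalIntegrable fun s hs => ContinuousAt.continuousWithinAt ?_
      have hs0 : s ≠ 0 := ((mem_Iic.1 (hsub hs)).trans_lt W.hu₀).ne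
      have : s ^ 2 ≠ 0 := pow_ne_zero 2 hs0
      fun_prop (disch := assumption)
    have hI : |∫ s in a..u, W.Ω2 s v * W.φu s v| ≤ ∫ s in a..u, (v ^ 2)⁻¹ *
        (c * M / W.r u₀ v₀ * |W.φu s v₀| + c ^ 2 * S / (W.r u₀ v₀ ^ 2 * v₀) *
          (Real.exp (-(l * s⁻¹)) * (s ^ 2)⁻¹)) := by
      rw [← Real.norm_eq_abs]
      refine intervalIntegral.norm_integral_le_of_norm_le ha
        (Eventually.of_forall fun s hs => ?_)
        (((hi1.const_mul _).add (hi2.const_mul _)).const_mul _)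
      have hs0 : s ≤ u₀ := hs.2.trans hu
      have h1 := W.abs_φu_le hc0.le hc hs0 hv.1
        fun t ht => hS s hs0 t ⟨ht.1, ht.2.trans hv.2⟩
      rw [Real.norm_eq_abs, abs_mul, abs_of_pos (W.Ω2_pos hs0 hv.1.le)]
      refine (mul_le_mul (W.Ω2_le_inv_sq_right hc hs0 hv.1.le) h1 (abs_nonneg _)
        (by positivity)).trans_eq ?_
      field_simp
    have hEint : ∫ s in a..u, Real.exp (-(l * s⁻¹)) * (s ^ 2)⁻¹ ≤ Real.exp (-(l * u⁻¹)) / l := by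
      rw [intervalIntegral.integral_eq_sub_of_hasDerivAt (fun s hs => hderiv s (hsub hs)) hi2]
      have : 0 ≤ Real.exp (-(l * a⁻¹)) / l := by positivity
      linarith
    have hQint : ∫ s in a..u, |W.φu s v₀| ≤ ∫ s in Iic u₀, |W.φu s v₀| := by
      rw [intervalIntegral.integral_of_le ha]
      exact setIntegral_mono_set hq.abs (Eventually.of_forall fun _ => abs_nonneg _)
        (Eventually.of_forall fun x hx => hx.2.trans hu)
    rw [intervalIntegral.integral_const_mul, intervalIntegral.integral_add
      (hi1.const_mul _) (hi2.const_mul _), intervalIntegral.integral_const_mul,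
      intervalIntegral.integral_const_mul, ← div_eq_inv_mul, le_div_iff₀ (by positivity)] at hI
    have h3 : |W.r u v * W.φv u v|
        ≤ |W.r a v * W.φv a v| + |∫ s in a..u, W.Ω2 s v * W.φu s v| := by
      rw [W.r_mul_φv_eq ha hu hv.1]
      exact abs_sub _ _
    have h4 : S / 2 * Real.exp (-(l * u⁻¹)) =
        c ^ 2 * S / (W.r u₀ v₀ ^ 2 * v₀) * (Real.exp (-(l * u⁻¹)) / l) := by
      have : c ^ 2 * S / (W.r u₀ v₀ ^ 2 * v₀) = S / 2 * l := by
        rw [hl]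
        ring
      rw [this]
      field_simp
    rw [h4]
    calc |W.r u v * W.φv u v| * v ^ 2
        ≤ (|W.r a v * W.φv a v| + |∫ s in a..u, W.Ω2 s v * W.φu s v|) * v ^ 2 := by gcongr
      _ ≤ |W.r a v * W.φv a v| * v ^ 2 + _ := by
        rw [add_mul]
        gcongr
        exact hI.trans (by gcongr)
  have hlim := (((W.tendsto_r_mul_φv hv.1.le).abs.mul_const (v ^ 2)).add_const
    (c * M / W.r u₀ v₀ * (∫ s in Iic u₀, |W.φu s v₀|) + S / 2 * Real.exp (-(l * u⁻¹))))
  refine (ge_of_tendsto hlim ((eventually_le_atBot u).mono hbound)).trans ?_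
  have h5 : |M * W.φH' v| * v ^ 2 ≤ M * C := by
    rw [abs_mul, abs_of_pos hM, mul_assoc]
    exact mul_le_mul_of_nonneg_left (hC v hv.1.le) hM.le
  have h6 : 0 ≤ K := by
    have : 0 ≤ M * C := (by positivity : (0 : ℝ) ≤ _).trans h5
    rw [hK]
    positivity
  have h7 : K ≤ K * Real.exp (-(l * u⁻¹)) := le_mul_of_one_le_right h6 hE1
  rw [add_mul]
  linarith

lemma exists_abs_r_mul_φv_mul_sq_le {L : ℝ}
    (hlim : Tendsto (fun v => v ^ 2 * W.φH' v) atTop (𝓝 L))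
    (hq : IntegrableOn (fun u => W.φu u v₀) (Iic u₀)) :
    ∃ A, 0 ≤ A ∧ ∀ u ≤ u₀, ∀ v, v₀ < v → |W.r u v * W.φv u v| * v ^ 2 ≤ A := by
  obtain ⟨c, hc0, hc⟩ := W.exists_Ω2_le
  obtain ⟨C, hC0, hC⟩ := W.exists_abs_φH'_mul_sq_le hlim
  have hM := W.hM
  have hv0 := W.hv₀
  have hr0 := W.r_pos le_rfl le_rfl
  obtain ⟨l, hl⟩ : ∃ l, l = 2 * c ^ 2 / (W.r u₀ v₀ ^ 2 * v₀) := ⟨_, rfl⟩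
  obtain ⟨K, hK⟩ : ∃ K, K = M * C + c * M / W.r u₀ v₀ * ∫ s in Iic u₀, |W.φu s v₀| := ⟨_, rfl⟩
  have hl0 : 0 < l := by rw [hl]; positivity
  have hK0 : 0 ≤ K := by
    have : 0 ≤ ∫ s in Iic u₀, |W.φu s v₀| := integral_nonneg fun _ => abs_nonneg _
    rw [hK]
    positivity
  refine ⟨2 * K * Real.exp (-(l * u₀⁻¹)), by positivity, fun u hu v hv => ?_⟩
  let T : Set ℝ := {x | ∃ u ≤ u₀, ∃ s ∈ Ioc v₀ v,
    x = |W.r u s * W.φv u s| * s ^ 2 / Real.exp (-(l * u⁻¹))}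
  have hT_mem : ∀ a ≤ u₀, ∀ s ∈ Ioc v₀ v,
      |W.r a s * W.φv a s| * s ^ 2 / Real.exp (-(l * a⁻¹)) ∈ T :=
    fun a ha s hs => ⟨a, ha, s, hs, rfl⟩
  have hT_bdd : BddAbove T := by
    obtain ⟨B, hB⟩ := W.exists_abs_φv_le v
    refine ⟨M * B * v ^ 2, ?_⟩
    rintro _ ⟨a, ha, s, hs, rfl⟩
    have hs0 : 0 < s := hv0.trans hs.1
    have hE1 : 1 ≤ Real.exp (-(l * a⁻¹)) := by
      have : a⁻¹ < 0 := inv_lt_zero.2 (ha.trans_lt W.hu₀)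
      exact Real.one_le_exp (by nlinarith)
    refine (div_le_self (by positivity) hE1).trans ?_
    rw [abs_mul, abs_of_pos (W.r_pos ha hs.1.le)]
    have h1 := (W.r_lt ha hs.1.le).le
    have h2 := hB a ha s (Ioc_subset_Icc_self hs)
    have h3 := hs.2
    have h4 := (abs_nonneg _).trans h2
    gcongr
  have hS : ∀ a ≤ u₀, ∀ s ∈ Ioc v₀ v,
      |W.r a s * W.φv a s| * s ^ 2 ≤ sSup T * Real.exp (-(l * a⁻¹)) := fun a ha s hs =>
    (div_le_iff₀ (Real.exp_pos _)).1 (le_csSup hT_bdd (hT_mem a ha s hs))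
  have hS0 : 0 ≤ sSup T :=
    (by positivity : (0 : ℝ) ≤ _).trans (le_csSup hT_bdd (hT_mem u hu v ⟨hv, le_rfl⟩))
  have hS2 : sSup T ≤ 2 * K := by
    have : sSup T ≤ K + sSup T / 2 := by
      refine csSup_le ⟨_, hT_mem u hu v ⟨hv, le_rfl⟩⟩ ?_
      rintro _ ⟨a, ha, s, hs, rfl⟩
      rw [div_le_iff₀ (Real.exp_pos _)]
      exact W.decay_step hc0 hc hC hq hl hK hS0 hS ha hs
    linarith
  refine (hS u hu v ⟨hv, le_rfl⟩).trans ?_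
  have hinv : u₀⁻¹ ≤ u⁻¹ := (inv_le_inv_of_neg W.hu₀ (hu.trans_lt W.hu₀)).2 hu
  gcongr

end WaveSetupH

namespace WaveSetup

variable {M u₀ v₀ : ℝ} (W : WaveSetup M u₀ v₀) {u c A : ℝ}

lemma exists_tendsto_φu (hc0 : 0 ≤ c)
    (hc : ∀ u ≤ u₀, ∀ v, v₀ ≤ v → W.Ω2 u v * (v - u) ^ 2 ≤ c) (hu : u ≤ u₀)
    (hA : ∀ v, v₀ < v → |W.r u v * W.φv u v| * v ^ 2 ≤ A) :
    ∃ ℓ, Tendsto (fun v => W.φu u v) atTop (𝓝 ℓ) := by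
  have hv0 := W.hv₀
  have hM := W.hM
  have hint : IntegrableOn (fun s => W.Ω2 u s * W.φv u s) (Ioi v₀) := by
    refine Integrable.mono' ((integrableOn_inv_sq measurableSet_Ioi hv0
      fun x hx => (le_of_lt hx).trans (le_abs_self x)).const_mul
        (c * (u ^ 2)⁻¹ * (A / W.r u₀ v₀)))
      (((continuousOn_right_of_prod (f := fun u v => W.Ω2 u v * W.φv u v)
        W.continuousOn_Ω2_mul_φv (mem_Iic.2 hu)).mono
        Ioi_subset_Ici_self).aestronglyMeasurable measurableSet_Ioi)
      ((ae_restrict_iff' measurableSet_Ioi).2 (Eventually.of_forall fun s hs => ?_))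
    have hs' : v₀ < s := hs
    have hs0 : 0 < s := hv0.trans hs'
    have h1 : |W.r u s * W.φv u s| ≤ A * (s ^ 2)⁻¹ := by
      rw [← div_eq_mul_inv, le_div_iff₀ (by positivity)]
      exact hA s hs
    have h2 := W.abs_le_of_abs_r_mul_le hu hs'.le h1
    rw [Real.norm_eq_abs, abs_mul, abs_of_pos (W.Ω2_pos hu hs'.le)]
    calc W.Ω2 u s * |W.φv u s| ≤ c * (u ^ 2)⁻¹ * (A * (s ^ 2)⁻¹ / W.r u₀ v₀) := by
          gcongr
          exact W.Ω2_le_inv_sq_left hc hu hs'.le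
      _ = _ := by ring
  have h1 := (intervalIntegral_tendsto_integral_Ioi v₀ hint tendsto_id).const_add
    (W.r u v₀ * W.φu u v₀)
  have h2 := W.tendsto_r (l := atTop) (a := fun _ : ℝ => u) (b := id)
    (Eventually.of_forall fun _ => hu) (eventually_ge_atTop v₀)
    (tendsto_atTop_add_const_right _ (-u) tendsto_id)
  refine ⟨_, (h1.div h2 hM.ne').congr' ?_⟩
  filter_upwards [eventually_ge_atTop v₀] with v hv
  have := W.r_pos hu hv
  simp only [Pi.div_apply, id]
  rw [← W.r_mul_φu_eq hu hv]
  field_simp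

section Limits

variable {ι : Type*} {l : Filter ι} {a b : ι → ℝ}

lemma tendsto_sub_div_self (hb : Tendsto b l atTop) (x : ℝ) :
    Tendsto (fun i => (b i - x) / b i) l (𝓝 1) := by
  have h : Tendsto (fun i => 1 - x * (b i)⁻¹) l (𝓝 1) := by
    simpa using (hb.inv_tendsto_atTop.const_mul x).const_sub 1
  refine h.congr' ?_
  filter_upwards [hb.eventually_gt_atTop 0] with i hi
  field_simp

lemma tendsto_Ω2_mul_sq_self (hu : u ≤ u₀) (hb : Tendsto b l atTop) :
    Tendsto (fun i => W.Ω2 u (b i) * b i ^ 2) l (𝓝 (M ^ 2)) := by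
  have h1 := W.tendsto_Ω2_mul_sq (Eventually.of_forall fun _ => hu)
    (hb.eventually_ge_atTop v₀) (tendsto_atTop_add_const_right _ (-u) hb)
  have h2 := h1.div ((tendsto_sub_div_self hb u).pow 2) (by norm_num)
  rw [one_pow, div_one] at h2
  refine h2.congr' ?_
  filter_upwards [hb.eventually_gt_atTop 0] with i hi
  have : b i - u ≠ 0 := by linarith [W.hu₀]
  simp only [Pi.div_apply]
  field_simp

lemma tendsto_inv_Ω2_mul_Ω2 (hu : u ≤ u₀) (hb : Tendsto b l atTop) :
    Tendsto (fun i => (W.Ω2 u₀ (b i))⁻¹ * W.Ω2 u (b i)) l (𝓝 1) := by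
  have hM := W.hM
  have h := (W.tendsto_Ω2_mul_sq_self hu hb).div (W.tendsto_Ω2_mul_sq_self le_rfl hb)
    (by positivity)
  rw [div_self (by positivity)] at h
  refine h.congr' ?_
  filter_upwards [hb.eventually_gt_atTop 0] with i hi
  simp only [Pi.div_apply]
  rw [mul_div_mul_right _ _ (by positivity), div_eq_inv_mul]

end Limits

end WaveSetup

namespace WaveSetupH

variable {M u₀ v₀ : ℝ} (W : WaveSetupH M u₀ v₀) {u v : ℝ} {h : ℝ → ℝ}

lemma integrableOn_Ω2_mul_φu (hh : IntegrableOn h (Iic u₀))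
    (hφu : ∀ u ≤ u₀, ∀ v, v₀ < v → |W.φu u v| ≤ h u) (hv : v₀ < v) :
    IntegrableOn (fun s => W.Ω2 s v * W.φu s v) (Iic u₀) := by
  refine Integrable.mono' (hh.const_mul (W.Ω2 u₀ v))
    ((continuousOn_left_of_prod (f := fun u v => W.Ω2 u v * W.φu u v)
      W.continuousOn_Ω2_mul_φu (mem_Ici.2 hv.le)).aestronglyMeasurable measurableSet_Iic)
    ((ae_restrict_iff' measurableSet_Iic).2 (Eventually.of_forall fun s hs => ?_))
  rw [Real.norm_eq_abs, abs_mul, abs_of_pos (W.Ω2_pos hs hv.le)]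
  exact mul_le_mul (W.Ω2_le_Ω2 hs hv.le) (hφu s hs v hv) (abs_nonneg _)
    (W.Ω2_pos le_rfl hv.le).le

lemma r_mul_φv_eq_integral_Iic (hh : IntegrableOn h (Iic u₀))
    (hφu : ∀ u ≤ u₀, ∀ v, v₀ < v → |W.φu u v| ≤ h u) (hu : u ≤ u₀) (hv : v₀ < v) :
    W.r u v * W.φv u v = M * W.φH' v - ∫ s in Iic u, W.Ω2 s v * W.φu s v := by
  have h1 := intervalIntegral_tendsto_integral_Iic u
    ((W.integrableOn_Ω2_mul_φu hh hφu hv).mono_set (Iic_subset_Iic.2 hu)) tendsto_id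
  refine tendsto_nhds_unique (tendsto_const_nhds (f := (atBot : Filter ℝ)))
    (((W.tendsto_r_mul_φv hv.le).sub h1).congr' ?_)
  filter_upwards [eventually_le_atBot u] with s hs
  exact (W.r_mul_φv_eq hs hu hv).symm

/-- The regular outgoing derivative has a limit as the Cauchy horizon is approached, jointly
in both null coordinates. -/
lemma exists_tendsto_dVφ {L x : ℝ} {ι : Type*} {l : Filter ι} [l.IsCountablyGenerated]
    {a b : ι → ℝ} (hlim : Tendsto (fun v => v ^ 2 * W.φH' v) atTop (𝓝 L))
    (hq : IntegrableOn (fun u => W.φu u v₀) (Iic u₀))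
    (ha : ∀ᶠ i in l, a i ≤ u₀) (hax : Tendsto a l (𝓝 x)) (hb : Tendsto b l atTop) :
    ∃ ℓ, Tendsto (fun i => W.dVφ (a i) (b i)) l (𝓝 ℓ) := by
  have hM := W.hM
  obtain ⟨c, hc0, hc⟩ := W.exists_Ω2_le
  obtain ⟨A, -, hA⟩ := W.exists_abs_r_mul_φv_mul_sq_le hlim hq
  have hsq := integrableOn_inv_sq measurableSet_Iic (neg_pos.2 W.hu₀)
    fun s hs => (neg_le_neg (mem_Iic.1 hs)).trans (neg_le_abs s)
  obtain ⟨h, hh, hφu⟩ : ∃ h : ℝ → ℝ, IntegrableOn h (Iic u₀) ∧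
      ∀ u ≤ u₀, ∀ v, v₀ < v → |W.φu u v| ≤ h u := by
    refine ⟨fun u => (M * |W.φu u v₀| + c * A / (W.r u₀ v₀ * v₀) * (u ^ 2)⁻¹) / W.r u₀ v₀,
      ?_, fun u hu v hv => W.abs_φu_le hc0.le hc hu hv fun s hs => hA u hu s hs.1⟩
    exact ((hq.abs.const_mul M).add (hsq.const_mul _)).div_const _
  have hex : ∀ u, ∃ ℓ, u ≤ u₀ → Tendsto (fun v => W.φu u v) atTop (𝓝 ℓ) := by
    intro u
    by_cases hu : u ≤ u₀
    · exact (W.exists_tendsto_φu hc0.le hc hu (hA u hu)).imp fun _ h _ => h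
    · exact ⟨0, fun h => absurd h hu⟩
  choose g hg using hex
  have hbv : ∀ᶠ i in l, v₀ < b i := hb.eventually_gt_atTop v₀
  have hI : Tendsto (fun i => ∫ s in Iic u₀, (Iic (a i)).indicator
      (fun s => (W.Ω2 u₀ (b i))⁻¹ * (W.Ω2 s (b i) * W.φu s (b i))) s) l
      (𝓝 (∫ s in Iic u₀, (Iic x).indicator g s)) := by
    refine tendsto_integral_filter_of_dominated_convergence h ?_ ?_ hh ?_
    · filter_upwards [hbv] with i hi
      exact (((W.integrableOn_Ω2_mul_φu hh hφu hi).const_mul _).indicator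
        measurableSet_Iic).aestronglyMeasurable
    · filter_upwards [hbv] with i hi
      refine (ae_restrict_iff' measurableSet_Iic).2 (Eventually.of_forall fun s hs => ?_)
      refine (norm_indicator_le_norm_self _ _).trans ?_
      have h0 := W.Ω2_pos le_rfl hi.le
      rw [← mul_assoc, norm_mul, Real.norm_eq_abs (W.φu s (b i)), Real.norm_of_nonneg
        (mul_nonneg (inv_nonneg.2 h0.le) (W.Ω2_pos hs hi.le).le), ← div_eq_inv_mul]
      exact (mul_le_of_le_one_left (abs_nonneg _)
        ((div_le_one h0).2 (W.Ω2_le_Ω2 hs hi.le))).trans (hφu s hs _ hi)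
    · have hne : ∀ᵐ s ∂(volume.restrict (Iic u₀)), s ≠ x :=
        ae_restrict_of_ae (compl_mem_ae_iff.2 (measure_singleton x))
      filter_upwards [ae_restrict_mem measurableSet_Iic, hne] with s hs hsx
      rcases hsx.lt_or_gt with hlt | hgt
      · have h1 := (W.tendsto_inv_Ω2_mul_Ω2 hs hb).mul ((hg s hs).comp hb)
        rw [one_mul] at h1
        rw [indicator_of_mem (mem_Iic.2 hlt.le)]
        refine h1.congr' ?_
        filter_upwards [hax.eventually_const_lt hlt] with i hi
        rw [indicator_of_mem (mem_Iic.2 hi.le), mul_assoc]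
        rfl
      · rw [indicator_of_notMem (notMem_Iic.2 hgt)]
        refine tendsto_const_nhds.congr' ?_
        filter_upwards [hax.eventually_lt_const hgt] with i hi
        rw [indicator_of_notMem (notMem_Iic.2 hi)]
  have hH : Tendsto (fun i => (W.Ω2 u₀ (b i))⁻¹ * (M * W.φH' (b i))) l (𝓝 (M * L / M ^ 2)) := by
    refine (((hlim.comp hb).const_mul M).div (W.tendsto_Ω2_mul_sq_self le_rfl hb)
      (by positivity)).congr' ?_
    filter_upwards [hb.eventually_gt_atTop 0, hbv] with i hi hi'
    have := W.Ω2_pos le_rfl hi'.le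
    simp only [Pi.div_apply, Function.comp]
    field_simp
  have hr := W.tendsto_r ha (hbv.mono fun _ => le_of_lt)
    (tendsto_atTop_mono' l (ha.mono fun i hi => sub_le_sub_left hi (b i))
      (tendsto_atTop_add_const_right _ (-u₀) hb))
  refine ⟨_, ((hH.sub hI).div hr hM.ne').congr' ?_⟩
  filter_upwards [ha, hbv] with i hi hi'
  have h0 := W.r_pos hi hi'.le
  have h1 := W.r_mul_φv_eq_integral_Iic hh hφu hi hi'
  simp only [Pi.div_apply]
  rw [setIntegral_indicator measurableSet_Iic, inter_eq_right.2 (Iic_subset_Iic.2 hi),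
    MeasureTheory.integral_const_mul, ← mul_sub, ← h1, WaveSetup.dVφ]
  field_simp

end WaveSetupH

/-- **`C¹`-extendibility of `φ₀` beyond the Cauchy horizon** (Proposition 4.11):
if `F_p[φ] < ∞` for some `0 < p < 1` and `lim_{v→∞} v² φ_H'(v)` exists, then the
regular outgoing derivative `∂_V φ = Ω^{-2}(u₀,v) ∂_v φ` extends continuously to
`(-∞,u₀] × [V₀,M]` in the regular coordinate `V(v) := r(u₀,v)`. -/
theorem C1_extendibility (M u₀ v₀ : ℝ) (W : WaveSetupH M u₀ v₀)
    (p : ℝ) (hp₁ : 0 < p) (hp₂ : p < 1)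
    (hFu : IntegrableOn (fun u' => |u'| ^ p * |W.φu u' v₀|) (Set.Iic u₀))
    (hFv : IntegrableOn (fun v' => |W.φH' v'|) (Set.Ioi v₀))
    (hlim : ∃ L : ℝ, Tendsto (fun v => v ^ 2 * W.φH' v) atTop (𝓝 L)) :
    ∃ Ψ : ℝ → ℝ → ℝ,
      ContinuousOn (fun x : ℝ × ℝ => Ψ x.1 x.2)
        (Set.Iic u₀ ×ˢ Set.Icc (W.r u₀ v₀) M) ∧
      ∀ u ≤ u₀, ∀ v : ℝ, v₀ ≤ v → Ψ u (W.r u₀ v) = W.toWaveSetup.dVφ u v := by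
  obtain ⟨L, hL⟩ := hlim
  have hM := W.hM
  have hq := W.integrableOn_φu_of_weighted hp₁ hFu
  have hV0 := W.r_pos le_rfl le_rfl
  have hV0M := W.r_lt le_rfl le_rfl
  have hmem : ∀ V ∈ Ico (W.r u₀ v₀) M, V ∈ Ioo 0 M := fun V hV => ⟨hV0.trans_le hV.1, hV.2⟩
  have hge : ∀ V ∈ Ico (W.r u₀ v₀) M, v₀ ≤ rstar M V + u₀ := by
    intro V hV
    have h1 := strictMonoOn_rstar.monotoneOn ⟨hV0.le, hV0M⟩ (Ioo_subset_Ico_self (hmem V hV)) hV.1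
    rw [W.hr_star u₀ v₀ W.hdom] at h1
    linarith
  have hfc : ContinuousOn (fun x : ℝ × ℝ => W.dVφ x.1 (rstar M x.2 + u₀))
      (Iic u₀ ×ˢ Ico (W.r u₀ v₀) M) := by
    have hv : ContinuousOn (fun x : ℝ × ℝ => rstar M x.2 + u₀)
        (Iic u₀ ×ˢ Ico (W.r u₀ v₀) M) := fun x hx =>
      (((hasDerivAt_rstar hx.2.2).continuousAt.comp
        (f := fun x : ℝ × ℝ => x.2) continuousAt_snd).add continuousAt_const).continuousWithinAt
    refine ContinuousOn.mul (ContinuousOn.inv₀ ?_ fun x hx =>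
      (W.Ω2_pos le_rfl (hge _ hx.2)).ne') ?_
    · exact (continuousOn_right_of_prod (f := W.Ω2) W.continuousOn_Ω2 self_mem_Iic).comp hv
        fun x hx => hge _ hx.2
    · exact W.hφv_cont.comp (continuousOn_fst.prodMk hv) fun x hx => ⟨hx.1, hge _ hx.2⟩
  let f : ℝ × ℝ → ℝ := fun x => W.dVφ x.1 (rstar M x.2 + u₀)
  refine ⟨fun u V => extendFrom (Iic u₀ ×ˢ Ico (W.r u₀ v₀) M) f (u, V), ?_, fun u hu v hv => ?_⟩
  · refine continuousOn_extendFrom ?_ fun x hx => ?_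
    · rw [closure_prod_eq, closure_Iic, closure_Ico hV0M.ne]
    · rcases hx.2.2.lt_or_eq with hlt | heq
      · exact ⟨_, hfc x ⟨hx.1, hx.2.1, hlt⟩⟩
      · refine W.exists_tendsto_dVφ hL hq (l := 𝓝[Iic u₀ ×ˢ Ico (W.r u₀ v₀) M] x)
          (a := Prod.fst) (b := fun y => rstar M y.2 + u₀) ?_
          (continuousWithinAt_fst) ?_
        · filter_upwards [self_mem_nhdsWithin] with y hy
          exact hy.1
        · refine tendsto_atTop_add_const_right _ u₀ ((tendsto_rstar_atTop hM).comp ?_)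
          refine tendsto_nhdsWithin_of_tendsto_nhds_of_eventually_within _ ?_ ?_
          · exact heq ▸ (continuousWithinAt_snd (s := Iic u₀ ×ˢ Ico (W.r u₀ v₀) M) (p := x)).tendsto
          · filter_upwards [self_mem_nhdsWithin] with y hy
            exact hy.2.2
  · have hd := W.dom le_rfl hv
    have hx : (u, W.r u₀ v) ∈ Iic u₀ ×ˢ Ico (W.r u₀ v₀) M :=
      ⟨hu, W.r_ge le_rfl hv, W.r_lt le_rfl hv⟩
    have h := extendFrom_eq (subset_closure hx) (hfc _ hx)
    refine h.trans ?_
    simp only [W.hr_star u₀ v hd, sub_add_cancel]
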